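/- Let a < b, κ ≠ 0 a real constant, ρ : [a,b] → ℝ continuous, and u ∈ C⁴([a,b]). If the first variation (d/dε)|_{ε=0} S(u + εv) of the beam action vanishes for every smooth v with compact support contained in the open interval (a,b), then u satisfies the Euler–Lagrange equation κ u''''(x) = ρ(x) for all x ∈ [a,b]. -/

import Mathlib

open Set

/-- `f` is of class `C⁴` on `s`, with successive derivatives `f1, f2, f3, f4`. -/
def IsC4On (f f1 f2 f3 f4 : ℝ → ℝ) (s : Set ℝ) : Prop :=
  (∀ x ∈ s, HasDerivWithinAt f (f1 x) s x) ∧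
  (∀ x ∈ s, HasDerivWithinAt f1 (f2 x) s x) ∧
  (∀ x ∈ s, HasDerivWithinAt f2 (f3 x) s x) ∧
  (∀ x ∈ s, HasDerivWithinAt f3 (f4 x) s x) ∧
  ContinuousOn f4 s

open MeasureTheory

/-- The derivative at zero of the beam action along `u + ε v`, with `p = u''` and
`q = v''`. -/
theorem hasDerivAt_beam_action {a b κ : ℝ} (hab : a ≤ b) {ρ u p v q : ℝ → ℝ}
    (hρ : ContinuousOn ρ (Icc a b)) (hu : ContinuousOn u (Icc a b))
    (hp : ContinuousOn p (Icc a b)) (hv : ContinuousOn v (Icc a b))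
    (hq : ContinuousOn q (Icc a b)) :
    HasDerivAt
      (fun ε : ℝ => ∫ x in a..b, (κ * (p x + ε * q x) ^ 2 / 2 - ρ x * (u x + ε * v x)))
      (∫ x in a..b, (κ * (p x * q x) - ρ x * v x)) 0 := by
  have hA : IntervalIntegrable (fun x => κ * p x ^ 2 / 2 - ρ x * u x) volume a b :=
    ContinuousOn.intervalIntegrable_of_Icc hab (by fun_prop)
  have hB : IntervalIntegrable (fun x => κ * (p x * q x) - ρ x * v x) volume a b :=
    ContinuousOn.intervalIntegrable_of_Icc hab (by fun_prop)
  have hC : IntervalIntegrable (fun x => κ * q x ^ 2 / 2) volume a b :=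
    ContinuousOn.intervalIntegrable_of_Icc hab (by fun_prop)
  have hexp : (fun ε : ℝ =>
      ∫ x in a..b, (κ * (p x + ε * q x) ^ 2 / 2 - ρ x * (u x + ε * v x))) =
      fun ε => (∫ x in a..b, (κ * p x ^ 2 / 2 - ρ x * u x)) +
        ε * (∫ x in a..b, (κ * (p x * q x) - ρ x * v x)) +
        ε ^ 2 * ∫ x in a..b, κ * q x ^ 2 / 2 := by
    funext ε
    rw [← intervalIntegral.integral_const_mul, ← intervalIntegral.integral_const_mul,
      ← intervalIntegral.integral_add hA (hB.const_mul ε),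
      ← intervalIntegral.integral_add (hA.add (hB.const_mul ε)) (hC.const_mul (ε ^ 2))]
    congr 1
    funext x
    ring
  rw [hexp]
  refine ((((hasDerivAt_id (0 : ℝ)).mul_const _).const_add _).add
    ((hasDerivAt_pow 2 (0 : ℝ)).mul_const _)).congr_deriv ?_
  simp

/-- Integrating by parts twice against a function vanishing to first order at the endpoints. -/
theorem integral_mul_second_deriv_eq {a b : ℝ} (hab : a ≤ b) {f f' f'' v v' v'' : ℝ → ℝ}
    (hf : ∀ x ∈ Icc a b, HasDerivWithinAt f (f' x) (Icc a b) x)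
    (hf' : ∀ x ∈ Icc a b, HasDerivWithinAt f' (f'' x) (Icc a b) x)
    (hf'' : ContinuousOn f'' (Icc a b))
    (hv : ∀ x ∈ Icc a b, HasDerivWithinAt v (v' x) (Icc a b) x)
    (hv' : ∀ x ∈ Icc a b, HasDerivWithinAt v' (v'' x) (Icc a b) x)
    (hv'' : ContinuousOn v'' (Icc a b))
    (hva : v a = 0) (hvb : v b = 0) (hva' : v' a = 0) (hvb' : v' b = 0) :
    ∫ x in a..b, f x * v'' x = ∫ x in a..b, f'' x * v x := by
  have hf'_int : IntervalIntegrable f' volume a b :=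
    ContinuousOn.intervalIntegrable_of_Icc hab fun x hx => (hf' x hx).continuousWithinAt
  have hv'_int : IntervalIntegrable v' volume a b :=
    ContinuousOn.intervalIntegrable_of_Icc hab fun x hx => (hv' x hx).continuousWithinAt
  have hf''_int := hf''.intervalIntegrable_of_Icc (μ := volume) hab
  have hv''_int := hv''.intervalIntegrable_of_Icc (μ := volume) hab
  rw [← uIcc_of_le hab] at hf hf' hv hv'
  rw [intervalIntegral.integral_mul_deriv_eq_deriv_mul_of_hasDerivWithinAt hf hv' hf'_int hv''_int,
    intervalIntegral.integral_mul_deriv_eq_deriv_mul_of_hasDerivWithinAt hf' hv hf''_int hv'_int,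
    hva, hvb, hva', hvb']
  ring

/-- The fundamental lemma of the calculus of variations on a compact interval, for smooth test
functions compactly supported in its interior. -/
theorem eqOn_zero_of_integral_mul_test_eq_zero {a b : ℝ} (hab : a < b) {g : ℝ → ℝ}
    (hg : ContinuousOn g (Icc a b))
    (h : ∀ v : ℝ → ℝ, ContDiff ℝ (⊤ : ℕ∞) v → HasCompactSupport v →
      tsupport v ⊆ Ioo a b → ∫ x in a..b, v x * g x = 0) :
    EqOn g 0 (Icc a b) := by
  have hloc : LocallyIntegrableOn g (Ioo a b) volume :=
    (hg.mono Ioo_subset_Icc_self).locallyIntegrableOn measurableSet_Ioo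
  have hae : ∀ᵐ x, x ∈ Ioo a b → g x = 0 := by
    refine isOpen_Ioo.ae_eq_zero_of_integral_contDiff_smul_eq_zero hloc fun v hv hvc hvs => ?_
    rw [← h v hv hvc hvs, intervalIntegral.integral_eq_integral_of_support_subset]
    · simp only [smul_eq_mul]
    · intro x hx
      exact Ioo_subset_Ioc_self
        (hvs (subset_tsupport v (Function.support_mul_subset_left v g hx)))
  refine Measure.eqOn_Icc_of_ae_eq volume hab.ne ?_ hg continuousOn_const
  rw [← Measure.restrict_congr_set (Ioo_ae_eq_Icc (μ := volume) (a := a) (b := b))]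
  exact (ae_restrict_iff' measurableSet_Ioo).2 hae

/-- If the first variation of the Bernoulli beam action
`S(u) = ∫ₐᵇ (κ u''²/2 − ρ u) dx` vanishes for every smooth direction `v` compactly
supported in the open interval `(a,b)`, then `u` satisfies the Euler–Lagrange
equation `κ u'''' = ρ` on all of `[a,b]`. -/
theorem beam_euler_lagrange_from_compactly_supported_variations
    (a b κ : ℝ) (hab : a < b) (hκ : κ ≠ 0)
    (ρ : ℝ → ℝ) (hρ : ContinuousOn ρ (Icc a b))
    (u u1 u2 u3 u4 : ℝ → ℝ) (hu : IsC4On u u1 u2 u3 u4 (Icc a b))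
    (hvar : ∀ v : ℝ → ℝ, ContDiff ℝ (⊤ : ℕ∞) v → HasCompactSupport v →
      tsupport v ⊆ Ioo a b →
      HasDerivAt
        (fun ε : ℝ => ∫ x in a..b,
          (κ * (u2 x + ε * iteratedDeriv 2 v x) ^ 2 / 2 - ρ x * (u x + ε * v x)))
        0 0) :
    ∀ x ∈ Icc a b, κ * u4 x = ρ x := by
  obtain ⟨hu0, hu1, hu2, hu3, hu4⟩ := hu
  have hu_cont : ContinuousOn u (Icc a b) := fun x hx => (hu0 x hx).continuousWithinAt
  have hu2_cont : ContinuousOn u2 (Icc a b) := fun x hx => (hu2 x hx).continuousWithinAt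
  have hzero : EqOn (fun x => κ * u4 x - ρ x) 0 (Icc a b) := by
    refine eqOn_zero_of_integral_mul_test_eq_zero hab (by fun_prop) fun v hv hvc hvs => ?_
    have hv' : ContDiff ℝ (⊤ : ℕ∞) (deriv v) := (contDiff_infty_iff_deriv.1 hv).2
    have hv'' : Continuous (deriv (deriv v)) := (contDiff_infty_iff_deriv.1 hv').2.continuous
    have hvanish : ∀ x ∉ Ioo a b, v x = 0 ∧ deriv v x = 0 := fun x hx =>
      ⟨image_eq_zero_of_notMem_tsupport fun hxv => hx (hvs hxv),
        image_eq_zero_of_notMem_tsupport fun hxv => hx (hvs (tsupport_deriv_subset hxv))⟩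
    have hparts := integral_mul_second_deriv_eq hab.le hu2 hu3 hu4
      (fun x _ => (contDiff_infty_iff_deriv.1 hv).1.differentiableAt.hasDerivAt.hasDerivWithinAt)
      (fun x _ => (contDiff_infty_iff_deriv.1 hv').1.differentiableAt.hasDerivAt.hasDerivWithinAt)
      hv''.continuousOn (hvanish a (by simp)).1 (hvanish b (by simp)).1
      (hvanish a (by simp)).2 (hvanish b (by simp)).2
    have hvar' := hvar v hv hvc hvs
    simp only [iteratedDeriv_succ, iteratedDeriv_zero] at hvar'
    have hweak := (hasDerivAt_beam_action (κ := κ) hab.le hρ hu_cont hu2_cont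
      hv.continuous.continuousOn hv''.continuousOn).unique hvar'
    have hvc' : ContinuousOn v (Icc a b) := hv.continuous.continuousOn
    have hvc'' : ContinuousOn (deriv (deriv v)) (Icc a b) := hv''.continuousOn
    have hint : IntervalIntegrable (fun x => ρ x * v x) volume a b :=
      ContinuousOn.intervalIntegrable_of_Icc hab.le (by fun_prop)
    have hint2 : IntervalIntegrable (fun x => κ * (u2 x * deriv (deriv v) x)) volume a b :=
      ContinuousOn.intervalIntegrable_of_Icc hab.le (by fun_prop)
    have hint4 : IntervalIntegrable (fun x => κ * (u4 x * v x)) volume a b :=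
      ContinuousOn.intervalIntegrable_of_Icc hab.le (by fun_prop)
    rw [intervalIntegral.integral_sub hint2 hint, intervalIntegral.integral_const_mul, hparts,
      ← intervalIntegral.integral_const_mul,
      ← intervalIntegral.integral_sub hint4 hint] at hweak
    rw [← hweak]
    congr 1
    funext x
    ring
  exact fun x hx => sub_eq_zero.1 (hzero hx)
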